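/- arXiv:1410.5604 — 2 statements merged into one kernel-verified Lean document; each statement's English description precedes it below -/
import Mathlib

section
/- Let C = ⟨(b(x) | 0), (ℓ(x) | a(x))⟩ be a Z₂-double cyclic code, where b(x) divides x^r−1, a(x) divides x^s−1, the subcode {(p(x) | 0) ∈ C} equals ⟨(b(x) | 0)⟩, and a(x) generates the projection C_s of C on the second factor. Then b(x) divides ((x^s−1)/a(x)) · gcd(ℓ(x), b(x)) in Z₂[x]. -/
open Polynomial

noncomputable section

/-- The polynomial ring `Z₂[x]`. -/
abbrev Z2P : Type := Polynomial (ZMod 2)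

/-- The quotient ring `Z₂[x]/(x^n - 1)`. -/
abbrev Rq (n : ℕ) : Type := Z2P ⧸ Ideal.span {(X : Z2P) ^ n - 1}

/-- The canonical projection `Z₂[x] → Z₂[x]/(x^n - 1)`. -/
def mkQ (n : ℕ) : Z2P →+* Rq n := Ideal.Quotient.mk _

theorem mkQ_eq_zero_iff {n : ℕ} {p : Z2P} : mkQ n p = 0 ↔ (X : Z2P) ^ n - 1 ∣ p :=
  Ideal.Quotient.eq_zero_iff_dvd _ _

theorem smul_mkQ (n : ℕ) (c p : Z2P) : c • mkQ n p = mkQ n (c * p) := rfl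

/-- Let `C = ⟨(b | 0), (ℓ | a)⟩` with `b ∣ x^r−1`, `a ∣ x^s−1`, such that the subcode
`{(p | 0) ∈ C}` equals `⟨(b | 0)⟩` and `a` generates the projection `C_s`.
Then `b ∣ ((x^s−1)/a)·gcd(ℓ, b)` in `Z₂[x]`. -/
theorem stmt6 (r s : ℕ) (hr : 0 < r) (hs : 0 < s) (b l a : Z2P)
    (hb : b ∣ (X : Z2P) ^ r - 1) (ha : a ∣ (X : Z2P) ^ s - 1)
    (hker : Submodule.span Z2P {((mkQ r b, 0) : Rq r × Rq s), (mkQ r l, mkQ s a)} ⊓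
        LinearMap.ker (LinearMap.snd Z2P (Rq r) (Rq s)) =
      Submodule.span Z2P {((mkQ r b, 0) : Rq r × Rq s)})
    (hCs : Submodule.map (LinearMap.snd Z2P (Rq r) (Rq s))
        (Submodule.span Z2P {((mkQ r b, 0) : Rq r × Rq s), (mkQ r l, mkQ s a)}) =
      Submodule.span Z2P {mkQ s a}) :
    b ∣ (((X : Z2P) ^ s - 1) / a) * gcd l b := by
  have hqa : ((X : Z2P) ^ s - 1) / a * a = (X : Z2P) ^ s - 1 := by
    rw [mul_comm]
    exact EuclideanDomain.mul_div_cancel' (ne_zero_of_dvd_ne_zero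
      (X_pow_sub_C_ne_zero hs 1) (by simpa using ha)) ha
  set q := ((X : Z2P) ^ s - 1) / a
  have hzero : q • mkQ s a = 0 := by
    rw [smul_mkQ, mkQ_eq_zero_iff, hqa]
  have hmem : q • ((mkQ r l, mkQ s a) : Rq r × Rq s) ∈
      Submodule.span Z2P {((mkQ r b, 0) : Rq r × Rq s)} := by
    rw [← hker]
    exact ⟨Submodule.smul_mem _ _ (Submodule.subset_span (by simp)), hzero⟩
  obtain ⟨c, hc⟩ := Submodule.mem_span_singleton.mp hmem
  have hfst : mkQ r (c * b) = mkQ r (q * l) := congrArg Prod.fst hc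
  have hdvd : b ∣ q * l := by
    have h : b ∣ c * b - q * l := by
      refine hb.trans (mkQ_eq_zero_iff.mp ?_)
      rw [map_sub, hfst, sub_self]
    exact (dvd_sub_right (dvd_mul_left b c)).mp h
  exact (dvd_gcd hdvd (dvd_mul_left b q)).trans (gcd_mul_left' q l b).dvd
end
end

section
/- Let C = ⟨(b(x) | 0), (ℓ(x) | a(x))⟩ be a Z₂-double cyclic code with b(x) | x^r−1, a(x) | x^s−1, the subcode {(p(x) | 0) ∈ C} equal to ⟨(b(x) | 0)⟩, and a(x) generating C_s. Write its dual as C^⊥ = ⟨(b̄(x) | 0), (ℓ̄(x) | ā(x))⟩ where b̄(x) | x^r−1, ā(x) | x^s−1, the subcode {(p(x) | 0) ∈ C^⊥} equals ⟨(b̄(x) | 0)⟩, and ā(x) generates (C^⊥)_s. Then deg b̄(x) = r − deg gcd(b(x), ℓ(x)). -/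
open Polynomial

noncomputable section

/-- The element of `Z₂[x]/(x^n − 1)` associated to a vector `v ∈ Z₂^n` via coefficients. -/
def ofVec (n : ℕ) (v : Fin n → ZMod 2) : Rq n :=
  mkQ n (∑ i : Fin n, Polynomial.C (v i) * (X : Z2P) ^ (i : ℕ))

/-- The dual code `C^⊥` of a `Z₂`-double cyclic code `C ⊆ R_{r,s}`, computed with respect to
the standard inner product on `Z₂^{r+s}` under the coefficient identification
`R_{r,s} ≅ Z₂^r × Z₂^s`. -/
def dualCode (r s : ℕ) (C : Submodule Z2P (Rq r × Rq s)) : Set (Rq r × Rq s) :=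
  {c | ∃ w : (Fin r → ZMod 2) × (Fin s → ZMod 2),
        (ofVec r w.1, ofVec s w.2) = c ∧
        ∀ u : (Fin r → ZMod 2) × (Fin s → ZMod 2),
          (ofVec r u.1, ofVec s u.2) ∈ C →
          (∑ i, u.1 i * w.1 i) + (∑ j, u.2 j * w.2 j) = 0}

/-- The polynomial of degree less than `n` with a given coefficient vector, as a linear map. -/
def vecPoly (n : ℕ) : (Fin n → ZMod 2) →ₗ[ZMod 2] Z2P :=
  (degreeLT (ZMod 2) n).subtype ∘ₗ (degreeLTEquiv (ZMod 2) n).symm.toLinearMap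

theorem vecPoly_apply (n : ℕ) (v : Fin n → ZMod 2) :
    vecPoly n v = ∑ i : Fin n, Polynomial.C (v i) * (X : Z2P) ^ (i : ℕ) := by
  simp [vecPoly, degreeLTEquiv, C_mul_X_pow_eq_monomial]

theorem ofVec_eq_mkQ_vecPoly (n : ℕ) (v : Fin n → ZMod 2) : ofVec n v = mkQ n (vecPoly n v) := by
  rw [vecPoly_apply, ofVec]

theorem degree_vecPoly_lt (n : ℕ) (v : Fin n → ZMod 2) : (vecPoly n v).degree < n :=
  mem_degreeLT.mp ((degreeLTEquiv (ZMod 2) n).symm v).2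

theorem vecPoly_injective (n : ℕ) : Function.Injective (vecPoly n) :=
  Subtype.val_injective.comp (degreeLTEquiv (ZMod 2) n).symm.injective

theorem exists_vecPoly_eq {n : ℕ} {p : Z2P} (hp : p.degree < n) : ∃ v, vecPoly n v = p :=
  ⟨degreeLTEquiv (ZMod 2) n ⟨p, mem_degreeLT.mpr hp⟩, by simp [vecPoly]⟩

theorem mkQ_eq_mkQ_iff {n : ℕ} {p q : Z2P} : mkQ n p = mkQ n q ↔ (X : Z2P) ^ n - 1 ∣ p - q := by
  rw [mkQ, Ideal.Quotient.mk_eq_mk_iff_sub_mem, Ideal.mem_span_singleton]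

theorem mkQ_smul (n : ℕ) (p q : Z2P) : p • mkQ n q = mkQ n (p * q) := rfl

theorem degree_X_pow_sub_one {n : ℕ} (hn : 0 < n) : ((X : Z2P) ^ n - 1).degree = n := by
  simpa using degree_X_pow_sub_C hn (1 : ZMod 2)

theorem ofVec_injective {n : ℕ} (hn : 0 < n) : Function.Injective (ofVec n) := by
  intro v w h
  rw [ofVec_eq_mkQ_vecPoly, ofVec_eq_mkQ_vecPoly, mkQ_eq_mkQ_iff, ← map_sub] at h
  have h0 := eq_zero_of_dvd_of_degree_lt h
    ((degree_vecPoly_lt n _).trans_eq (degree_X_pow_sub_one hn).symm)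
  exact sub_eq_zero.mp (vecPoly_injective n (h0.trans (map_zero _).symm))

theorem ofVec_surjective {n : ℕ} (hn : 0 < n) : Function.Surjective (ofVec n) := by
  intro q
  obtain ⟨p, rfl⟩ := Ideal.Quotient.mk_surjective q
  have h0 : (X : Z2P) ^ n - 1 ≠ 0 := ne_zero_of_degree_gt (degree_X_pow_sub_one hn ▸
    (by exact_mod_cast hn : (0 : WithBot ℕ) < n))
  obtain ⟨v, hv⟩ := exists_vecPoly_eq
    ((EuclideanDomain.mod_lt p h0).trans_eq (degree_X_pow_sub_one hn))
  refine ⟨v, ?_⟩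
  rw [ofVec_eq_mkQ_vecPoly, hv]
  refine mkQ_eq_mkQ_iff.mpr ((dvd_sub_comm).mp ⟨p / (X ^ n - 1), ?_⟩)
  rw [sub_eq_iff_eq_add]
  exact (EuclideanDomain.div_add_mod p _).symm

/-- The vectors of length `n` whose polynomial is a multiple of `d`. -/
def multiples (n : ℕ) (d : Z2P) : Submodule (ZMod 2) (Fin n → ZMod 2) :=
  ((Ideal.span {d}).restrictScalars (ZMod 2)).comap (vecPoly n)

theorem mem_multiples {n : ℕ} {d : Z2P} {v : Fin n → ZMod 2} :
    v ∈ multiples n d ↔ d ∣ vecPoly n v := by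
  simp [multiples, Ideal.mem_span_singleton]

theorem finrank_multiples_add_natDegree {n : ℕ} {d : Z2P} (hd : d ≠ 0) (hn : d.natDegree ≤ n) :
    Module.finrank (ZMod 2) (multiples n d) + d.natDegree = n := by
  let f : (Fin n → ZMod 2) →ₗ[ZMod 2] (Z2P ⧸ Ideal.span {d}) :=
    (Ideal.Quotient.mkₐ (ZMod 2) (Ideal.span {d})).toLinearMap ∘ₗ vecPoly n
  have hker : LinearMap.ker f = multiples n d := by
    ext v
    simp [f, mem_multiples, Ideal.Quotient.eq_zero_iff_mem, Ideal.mem_span_singleton]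
  have hrange : LinearMap.range f = ⊤ := by
    refine LinearMap.range_eq_top.mpr fun q => ?_
    obtain ⟨p, rfl⟩ := Ideal.Quotient.mk_surjective q
    obtain ⟨v, hv⟩ := exists_vecPoly_eq (n := n) ((EuclideanDomain.mod_lt p hd).trans_le
      (degree_le_natDegree.trans (by exact_mod_cast hn)))
    refine ⟨v, ?_⟩
    change Ideal.Quotient.mk _ (vecPoly n v) = _
    rw [hv, Ideal.Quotient.mk_eq_mk_iff_sub_mem, Ideal.mem_span_singleton, dvd_sub_comm]
    refine ⟨p / d, ?_⟩
    rw [sub_eq_iff_eq_add]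
    exact (EuclideanDomain.div_add_mod p _).symm
  have h := f.finrank_range_add_finrank_ker
  rw [hker, hrange, finrank_top, finrank_quotient_span_eq_natDegree, Module.finrank_fin_fun] at h
  omega

theorem mkQ_mem_span_singleton {n : ℕ} {d p : Z2P} (hd : d ∣ X ^ n - 1) :
    mkQ n p ∈ Submodule.span Z2P {mkQ n d} ↔ d ∣ p := by
  rw [Submodule.mem_span_singleton]
  constructor
  · rintro ⟨c, hc⟩
    rw [mkQ_smul, mkQ_eq_mkQ_iff] at hc
    exact (dvd_sub_right (dvd_mul_left d c)).mp (hd.trans hc)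
  · rintro ⟨c, rfl⟩
    exact ⟨c, by rw [mkQ_smul, mul_comm]⟩

theorem exists_mem_span_of_gcd_dvd (r s : ℕ) (b l a : Z2P) {p : Z2P} (hp : gcd b l ∣ p) :
    ∃ q : Rq s, (mkQ r p, q) ∈
      Submodule.span Z2P {((mkQ r b, 0) : Rq r × Rq s), (mkQ r l, mkQ s a)} := by
  obtain ⟨x, y, hxy⟩ : ∃ x y, p = b * x + l * y := by
    have : p ∈ Ideal.span {b, l} := by
      rwa [← _root_.span_gcd, Ideal.mem_span_singleton]
    obtain ⟨x, y, h⟩ := Ideal.mem_span_pair.mp this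
    exact ⟨x, y, by rw [← h]; ring⟩
  refine ⟨y • mkQ s a, Submodule.mem_span_pair.mpr ⟨x, y, ?_⟩⟩
  simp [mkQ_smul, hxy, mul_comm]

theorem gcd_dvd_of_mem_span {r s : ℕ} {b l a p : Z2P} {q : Rq s} (hb : b ∣ X ^ r - 1)
    (h : (mkQ r p, q) ∈
      Submodule.span Z2P {((mkQ r b, 0) : Rq r × Rq s), (mkQ r l, mkQ s a)}) :
    gcd b l ∣ p := by
  obtain ⟨x, y, hxy⟩ := Submodule.mem_span_pair.mp h
  have h1 := congrArg Prod.fst hxy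
  simp only [Prod.smul_mk, Prod.mk_add_mk, mkQ_smul, ← map_add, mkQ_eq_mkQ_iff] at h1
  exact (dvd_sub_right (dvd_add ((gcd_dvd_left b l).mul_left x)
    ((gcd_dvd_right b l).mul_left y))).mp (((gcd_dvd_left b l).trans hb).trans h1)

theorem finrank_add_finrank_of_dotProduct_eq_zero (n : ℕ) (V W : Submodule (ZMod 2) (Fin n → ZMod 2))
    (h : ∀ w, w ∈ W ↔ ∀ v ∈ V, ∑ i, v i * w i = 0) :
    Module.finrank (ZMod 2) W + Module.finrank (ZMod 2) V = n := by
  have hB : (Matrix.toBilin' (1 : Matrix (Fin n) (Fin n) (ZMod 2))).Nondegenerate :=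
    LinearMap.BilinForm.nondegenerate_toBilin'_of_det_ne_zero' _ (by simp)
  have hW : W = (Matrix.toBilin' (1 : Matrix (Fin n) (Fin n) (ZMod 2))).orthogonal V := by
    ext w
    simp [h, LinearMap.BilinForm.mem_orthogonal_iff,
      Matrix.toBilin'_apply', dotProduct]
  have hle := Submodule.finrank_le V
  rw [hW, LinearMap.BilinForm.finrank_orthogonal hB, Module.finrank_fin_fun]
  rw [Module.finrank_fin_fun] at hle
  omega

/-- Let `C = ⟨(b | 0), (ℓ | a)⟩` be a `Z₂`-double cyclic code (with the canonical conditions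
on the generators) and write `C^⊥ = ⟨(b̄ | 0), (ℓ̄ | ā)⟩` with the analogous canonical
conditions. Then `deg b̄ = r − deg gcd(b, ℓ)`. -/
theorem stmt12 (r s : ℕ) (hr : 0 < r) (hs : 0 < s) (b l a bb ll aa : Z2P)
    (C : Submodule Z2P (Rq r × Rq s))
    (hCdef : C = Submodule.span Z2P {((mkQ r b, 0) : Rq r × Rq s), (mkQ r l, mkQ s a)})
    (hb : b ∣ (X : Z2P) ^ r - 1) (ha : a ∣ (X : Z2P) ^ s - 1)
    (hker : C ⊓ LinearMap.ker (LinearMap.snd Z2P (Rq r) (Rq s)) =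
      Submodule.span Z2P {((mkQ r b, 0) : Rq r × Rq s)})
    (hCs : Submodule.map (LinearMap.snd Z2P (Rq r) (Rq s)) C =
      Submodule.span Z2P {mkQ s a})
    (hbb : bb ∣ (X : Z2P) ^ r - 1) (haa : aa ∣ (X : Z2P) ^ s - 1)
    (hdual : dualCode r s C =
      (Submodule.span Z2P {((mkQ r bb, 0) : Rq r × Rq s), (mkQ r ll, mkQ s aa)} :
        Set (Rq r × Rq s)))
    (hkerdual : {c : Rq r × Rq s | c ∈ dualCode r s C ∧ c.2 = 0} =
      (Submodule.span Z2P {((mkQ r bb, 0) : Rq r × Rq s)} : Set (Rq r × Rq s)))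
    (hCsdual : {q : Rq s | ∃ p : Rq r, (p, q) ∈ dualCode r s C} =
      (Submodule.span Z2P {mkQ s aa} : Set (Rq s))) :
    bb.natDegree = r - (gcd b l).natDegree := by
  have hmem : ∀ w, w ∈ multiples r bb ↔
      ∀ v ∈ multiples r (gcd b l), ∑ i, v i * w i = 0 := by
    intro w
    have h0 : ofVec s 0 = 0 := by simp [ofVec]
    have hw : w ∈ multiples r bb ↔ (ofVec r w, (0 : Rq s)) ∈ dualCode r s C := by
      have h1 : (ofVec r w, (0 : Rq s)) ∈ dualCode r s C ↔
          (ofVec r w, (0 : Rq s)) ∈ Submodule.span Z2P {((mkQ r bb, 0) : Rq r × Rq s)} := by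
        simpa using Set.ext_iff.mp hkerdual (ofVec r w, 0)
      rw [h1, mem_multiples, ← mkQ_mem_span_singleton hbb, ofVec_eq_mkQ_vecPoly,
        Submodule.mem_span_singleton, Submodule.mem_span_singleton]
      simp
    rw [hw]
    constructor
    · rintro ⟨⟨w₁, w₂⟩, hw', hdot⟩ v hv
      obtain ⟨h1, h2⟩ := Prod.ext_iff.mp hw'
      obtain rfl := ofVec_injective hr h1
      obtain rfl := ofVec_injective hs (h2.trans h0.symm)
      obtain ⟨q, hq⟩ := exists_mem_span_of_gcd_dvd r s b l a (mem_multiples.mp hv)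
      obtain ⟨u, rfl⟩ := ofVec_surjective hs q
      simpa using hdot (v, u) (by rw [hCdef, ofVec_eq_mkQ_vecPoly r]; exact hq)
    · intro h
      refine ⟨(w, 0), by rw [h0], fun u hu => ?_⟩
      rw [hCdef, ofVec_eq_mkQ_vecPoly r] at hu
      simpa using h u.1 (mem_multiples.mpr (gcd_dvd_of_mem_span hb hu))
  have hX : (X : Z2P) ^ r - 1 ≠ 0 := X_pow_sub_C_ne_zero hr 1
  have hdeg : ((X : Z2P) ^ r - 1).natDegree = r := natDegree_X_pow_sub_C
  have hg : gcd b l ∣ (X : Z2P) ^ r - 1 := (gcd_dvd_left b l).trans hb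
  have h1 := finrank_multiples_add_natDegree (ne_zero_of_dvd_ne_zero hX hbb)
    ((natDegree_le_of_dvd hbb hX).trans_eq hdeg)
  have h2 := finrank_multiples_add_natDegree (ne_zero_of_dvd_ne_zero hX hg)
    ((natDegree_le_of_dvd hg hX).trans_eq hdeg)
  have h3 := finrank_add_finrank_of_dotProduct_eq_zero r _ _ hmem
  omega
end
end
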